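/- Let n ≥ 1, μ > 0, α > 0, γ ≥ 0, χ > 0, t, t' > 0, x, x' ∈ ℝⁿ, and 0 < b < n. Let L : (0,∞) → (0,∞) be slowly varying at infinity and bounded on each finite interval, and set K(n,b) := Γ((n−b)/2)/(2^b π^{n/2} Γ(b/2)). Let ρ ≥ 1 be an integer and g : ℝⁿ → [0,∞) measurable such that g is bounded on {|λ| ≥ δ₀} for every δ₀ > 0 and g(λ)·|λ|^{n−b}/(K(n,b)·L^ρ(1/|λ|)) → 1 as λ → 0. Then lim_{ε→0⁺} ε^{nχ}·(ε^{bχ} L^ρ(ε^{−χ}))^{−1}·∫_{ℝⁿ} e^{i⟨x−x',τ⟩} e^{−μ(t+t')|τ|^α(ε^{2/(α+γ)}+|τ|²)^{γ/2}} g(ε^χ τ) dτ = K(n,b)·∫_{ℝⁿ} e^{i⟨x−x',τ⟩} e^{−μ(t+t')|τ|^{α+γ}} |τ|^{b−n} dτ. -/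

import Mathlib

open MeasureTheory Filter Topology
open scoped RealInnerProductSpace

/-- `L` is slowly varying at infinity: `L(cy)/L(y) → 1` as `y → ∞`, uniformly
for `c` in compact subintervals of `(0,∞)`. -/
def SlowlyVaryingAtTop (L : ℝ → ℝ) : Prop :=
  ∀ a b : ℝ, 0 < a → a < b →
    TendstoUniformlyOn (fun y c => L (c * y) / L y) (fun _ => 1) atTop (Set.Icc a b)

/-- The Tauberian constant `K(n,c) = Γ((n−c)/2)/(2^c π^{n/2} Γ(c/2))`. -/
noncomputable def tauberK (n : ℕ) (c : ℝ) : ℝ :=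
  Real.Gamma (((n : ℝ) - c) / 2) /
    ((2 : ℝ) ^ c * Real.pi ^ ((n : ℝ) / 2) * Real.Gamma (c / 2))

theorem tauberK_pos {n : ℕ} {c : ℝ} (hc : 0 < c) (hcn : c < n) : 0 < tauberK n c := by
  have h₁ : 0 < Real.Gamma (((n : ℝ) - c) / 2) := Real.Gamma_pos_of_pos (by linarith)
  have h₂ : 0 < Real.Gamma (c / 2) := Real.Gamma_pos_of_pos (by linarith)
  have h₃ := Real.pi_pos
  unfold tauberK
  positivity

namespace SlowlyVaryingAtTop

theorem tendsto_div {L : ℝ → ℝ} (hL : SlowlyVaryingAtTop L) {c : ℝ} (hc : 0 < c) :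
    Tendsto (fun y => L (c * y) / L y) atTop (𝓝 1) :=
  (hL c (c + 1) hc (by linarith)).tendsto_at (Set.left_mem_Icc.2 (by linarith))

/-- One dyadic step at a time, a slowly varying function grows by a factor at most `q`. -/
theorem exists_le_pow_mul {L : ℝ → ℝ} (hL : SlowlyVaryingAtTop L) (hLpos : ∀ y > 0, 0 < L y)
    {q : ℝ} (hq : 1 < q) :
    ∃ Y : ℝ, 1 ≤ Y ∧ ∀ k : ℕ, ∀ u v : ℝ, Y ≤ u → Y ≤ v → u ≤ 2 ^ k * v → v ≤ 2 ^ k * u →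
      L u ≤ q ^ k * L v := by
  have h := Metric.tendstoUniformlyOn_iff.1 (hL (1 / 2) 2 (by norm_num) (by norm_num)) (q - 1)
    (by linarith)
  obtain ⟨Y, hY⟩ := eventually_atTop.1 h
  have step : ∀ u w : ℝ, max Y 1 ≤ w → u ≤ 2 * w → w ≤ 2 * u → L u ≤ q * L w := by
    intro u w hw huw hwu
    have hw0 : 0 < w := by linarith [le_max_right Y 1]
    have h₁ := hY w (le_trans (le_max_left _ _) hw) (u / w)
      ⟨by rw [le_div_iff₀ hw0]; linarith, by rw [div_le_iff₀ hw0]; linarith⟩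
    rw [div_mul_cancel₀ _ hw0.ne', Real.dist_eq, abs_lt] at h₁
    have h₂ : L u / L w ≤ q := by linarith [h₁.1]
    rwa [div_le_iff₀ (hLpos w hw0)] at h₂
  refine ⟨max Y 1, le_max_right _ _, fun k => ?_⟩
  induction k with
  | zero =>
    intro u v _ _ huv hvu
    rw [pow_zero, one_mul] at *
    rw [le_antisymm huv hvu]
  | succ k ih =>
    intro u v hu hv huv hvu
    have hu0 : 0 < u := by linarith [le_max_right Y 1]
    have hv0 : 0 < v := by linarith [le_max_right Y 1]
    have hk : (1 : ℝ) ≤ 2 ^ k := one_le_pow₀ (by norm_num)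
    have hk0 : (0 : ℝ) < 2 ^ k := by positivity
    rw [pow_succ] at huv hvu
    have hq0 : 0 < q := by linarith
    obtain ⟨w, hw, huw, hwu, hwv, hvw⟩ : ∃ w, max Y 1 ≤ w ∧ u ≤ 2 * w ∧ w ≤ 2 * u ∧
        w ≤ 2 ^ k * v ∧ v ≤ 2 ^ k * w := by
      rcases le_total v u with hvu' | huv'
      · refine ⟨min u (2 ^ k * v), le_min hu (by nlinarith), ?_, ?_, min_le_right _ _, ?_⟩
        · rw [mul_min_of_nonneg _ _ (by norm_num)]
          exact le_min (by linarith) (by linarith)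
        · exact (min_le_left _ _).trans (by linarith)
        · rw [mul_min_of_nonneg _ _ hk0.le]
          exact le_min (by nlinarith) (by nlinarith [mul_pos hk0 hv0])
      · refine ⟨max u (v / 2 ^ k), hu.trans (le_max_left _ _), ?_, ?_, ?_, ?_⟩
        · linarith [le_max_left u (v / 2 ^ k)]
        · exact max_le (by linarith) (by rw [div_le_iff₀ hk0]; linarith)
        · exact max_le (by nlinarith) ((div_le_self hv0.le hk).trans (by nlinarith))
        · rw [← div_le_iff₀' hk0]
          exact le_max_right _ _
    calc L u ≤ q * L w := step u w hw huw hwu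
      _ ≤ q * (q ^ k * L v) := by gcongr; exact ih w v hw hv hwv hvw
      _ = q ^ (k + 1) * L v := by ring

/-- A Potter-type bound for slowly varying functions. -/
theorem exists_le_rpow_mul {L : ℝ → ℝ} (hL : SlowlyVaryingAtTop L) (hLpos : ∀ y > 0, 0 < L y)
    {η : ℝ} (hη : 0 < η) :
    ∃ Y : ℝ, 1 ≤ Y ∧ ∀ u v r : ℝ, Y ≤ u → Y ≤ v → u ≤ r * v → v ≤ r * u →
      L u ≤ (2 * r) ^ η * L v := by
  obtain ⟨Y, hY1, hY⟩ := hL.exists_le_pow_mul hLpos (Real.one_lt_rpow one_lt_two hη)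
  refine ⟨Y, hY1, fun u v r hu hv huv hvu => ?_⟩
  have hu0 : 0 < u := by linarith
  have hv0 : 0 < v := by linarith
  have hr : 1 ≤ r := by
    by_contra! h
    nlinarith
  obtain ⟨k, hk, hk'⟩ := exists_nat_pow_near hr one_lt_two
  refine (hY (k + 1) u v hu hv (huv.trans (by gcongr)) (hvu.trans (by gcongr))).trans ?_
  have hLv := (hLpos v hv0).le
  rw [Real.rpow_pow_comm (by norm_num)]
  gcongr
  rw [pow_succ]
  linarith

/-- A Potter-type bound for powers of slowly varying functions. -/
theorem exists_pow_le_rpow_mul {L : ℝ → ℝ} (hL : SlowlyVaryingAtTop L)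
    (hLpos : ∀ y > 0, 0 < L y) {ρ : ℕ} (hρ : ρ ≠ 0) {η : ℝ} (hη : 0 < η) :
    ∃ Y : ℝ, 1 ≤ Y ∧ ∀ u v r : ℝ, Y ≤ u → Y ≤ v → u ≤ r * v → v ≤ r * u →
      L u ^ ρ ≤ (2 * r) ^ η * L v ^ ρ := by
  have hρ' : (0 : ℝ) < ρ := by positivity
  obtain ⟨Y, hY1, hY⟩ := hL.exists_le_rpow_mul hLpos (div_pos hη hρ')
  refine ⟨Y, hY1, fun u v r hu hv huv hvu => ?_⟩
  have hu0 : 0 < u := by linarith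
  have hv0 : 0 < v := by linarith
  have hr : 0 < r := pos_of_mul_pos_left (hu0.trans_le huv) hv0.le
  calc L u ^ ρ ≤ ((2 * r) ^ (η / ρ) * L v) ^ ρ :=
        pow_le_pow_left₀ (hLpos u hu0).le (hY u v r hu hv huv hvu) ρ
    _ = (2 * r) ^ η * L v ^ ρ := by
        rw [mul_pow, ← Real.rpow_mul_natCast (by positivity), div_mul_cancel₀ _ hρ'.ne']

end SlowlyVaryingAtTop

theorem integrable_exp_neg_mul_norm_rpow_mul_norm_rpow {n : ℕ} (hn : 1 ≤ n) {c p r : ℝ}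
    (hc : 0 < c) (hp : 0 < p) (hr : 0 < n + r) :
    Integrable fun τ : EuclideanSpace ℝ (Fin n) =>
      Real.exp (-(c * ‖τ‖ ^ p)) * ‖τ‖ ^ r := by
  have : Nonempty (Fin n) := ⟨⟨0, hn⟩⟩
  rw [integrable_fun_norm_addHaar volume (f := fun y : ℝ => Real.exp (-(c * y ^ p)) * y ^ r)]
  refine (integrableOn_rpow_mul_exp_neg_mul_rpow (s := n + r - 1) (by linarith) hp hc).congr_fun
    (fun y hy => ?_) measurableSet_Ioi
  have hy : (0 : ℝ) < y := hy
  simp only [finrank_euclideanSpace, Fintype.card_fin, smul_eq_mul]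
  rw [← Real.rpow_natCast, Nat.cast_sub hn, neg_mul, mul_left_comm, ← Real.rpow_add hy, mul_comm]
  congr 2
  push_cast
  ring

theorem tendsto_rpow_nhdsGT_zero {p : ℝ} (hp : 0 < p) :
    Tendsto (fun ε : ℝ => ε ^ p) (𝓝[>] 0) (𝓝[>] 0) := by
  refine tendsto_nhdsWithin_iff.2 ⟨?_, ?_⟩
  · have h := (Real.continuousAt_rpow_const 0 p (Or.inr hp.le)).tendsto
    rw [Real.zero_rpow hp.ne'] at h
    exact h.mono_left nhdsWithin_le_nhds
  · filter_upwards [self_mem_nhdsWithin] with ε hε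
    exact Real.rpow_pos_of_pos hε p

section RescaledDensity

variable {E : Type*} [NormedAddCommGroup E] [NormedSpace ℝ E] {L : ℝ → ℝ} {ρ : ℕ} {g : E → ℝ}
  {d b K : ℝ}

theorem tendsto_rescaled_density (hL : SlowlyVaryingAtTop L) (hLpos : ∀ y > 0, 0 < L y)
    (hK : 0 < K)
    (hg : Tendsto (fun l : E => g l * ‖l‖ ^ (d - b) / (K * L (1 / ‖l‖) ^ ρ)) (𝓝[≠] 0) (𝓝 1))
    {τ : E} (hτ : τ ≠ 0) :
    Tendsto (fun s : ℝ => s ^ d * (s ^ b * L s⁻¹ ^ ρ)⁻¹ * g (s • τ)) (𝓝[>] 0)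
      (𝓝 (K * ‖τ‖ ^ (b - d))) := by
  have hτ' : 0 < ‖τ‖ := norm_pos_iff.2 hτ
  have h₁ : Tendsto (fun s : ℝ => s • τ) (𝓝[>] 0) (𝓝[≠] 0) := by
    refine tendsto_nhdsWithin_iff.2 ⟨?_, ?_⟩
    · have : Tendsto (fun s : ℝ => s • τ) (𝓝 0) (𝓝 ((0 : ℝ) • τ)) :=
        (continuous_id.smul continuous_const).tendsto 0
      rw [zero_smul] at this
      exact this.mono_left nhdsWithin_le_nhds
    · filter_upwards [self_mem_nhdsWithin] with s hs
      exact smul_ne_zero (ne_of_gt hs) hτ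
  have h₂ := ((hL.tendsto_div (inv_pos.2 hτ')).comp tendsto_inv_nhdsGT_zero).pow ρ
  have h₃ := ((hg.comp h₁).mul h₂).const_mul (K * ‖τ‖ ^ (b - d))
  rw [one_pow, mul_one, mul_one] at h₃
  refine h₃.congr' ?_
  filter_upwards [self_mem_nhdsWithin] with s hs
  have hs : 0 < s := hs
  have hinv : 1 / (s * ‖τ‖) = ‖τ‖⁻¹ * s⁻¹ := by rw [one_div, mul_inv, mul_comm]
  have hL₁ : 0 < L s⁻¹ := hLpos _ (by positivity)
  have hL₂ : 0 < L (‖τ‖⁻¹ * s⁻¹) := hLpos _ (by positivity)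
  simp only [Function.comp_apply, norm_smul, Real.norm_eq_abs, abs_of_pos hs, hinv]
  rw [Real.mul_rpow hs.le hτ'.le, Real.rpow_sub hs, Real.rpow_sub hτ', Real.rpow_sub hτ']
  have := Real.rpow_pos_of_pos hs b
  have := Real.rpow_pos_of_pos hτ' b
  have := Real.rpow_pos_of_pos hτ' d
  rw [div_pow]
  generalize L s⁻¹ = A at *
  generalize L (‖τ‖⁻¹ * s⁻¹) = B at *
  field_simp

theorem exists_rescaled_density_le (hL : SlowlyVaryingAtTop L) (hLpos : ∀ y > 0, 0 < L y)
    (hρ : ρ ≠ 0) (hK : 0 < K)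
    (hgbdd : ∀ δ > 0, ∃ C, ∀ l : E, δ ≤ ‖l‖ → g l ≤ C)
    (hg : Tendsto (fun l : E => g l * ‖l‖ ^ (d - b) / (K * L (1 / ‖l‖) ^ ρ)) (𝓝[≠] 0) (𝓝 1))
    {η : ℝ} (hη : 0 < η) (hηd : η ≤ d - b) :
    ∃ C₁ C₂ : ℝ, ∀ᶠ s : ℝ in 𝓝[>] 0, ∀ τ : E, τ ≠ 0 →
      s ^ d * (s ^ b * L s⁻¹ ^ ρ)⁻¹ * g (s • τ) ≤
        C₁ * (‖τ‖ ^ (b - d + η) + ‖τ‖ ^ (b - d - η)) + C₂ := by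
  obtain ⟨Y, hY1, hY⟩ := hL.exists_pow_le_rpow_mul hLpos hρ hη
  have hY0 : 0 < Y := by linarith
  obtain ⟨δ, hδ, hgδ⟩ : ∃ δ > 0, ∀ l : E, l ≠ 0 → ‖l‖ < δ →
      g l * ‖l‖ ^ (d - b) ≤ 2 * K * L (1 / ‖l‖) ^ ρ := by
    have := hg.eventually (gt_mem_nhds one_lt_two)
    rw [eventually_nhdsWithin_iff, Metric.eventually_nhds_iff] at this
    obtain ⟨δ, hδ, h⟩ := this
    refine ⟨δ, hδ, fun l hl hlδ => ?_⟩
    have hl' := h (by simpa using hlδ) hl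
    have : 0 < L (1 / ‖l‖) := hLpos _ (one_div_pos.2 (norm_pos_iff.2 hl))
    rw [div_lt_iff₀ (by positivity)] at hl'
    linarith
  obtain ⟨M, hM⟩ := hgbdd (min δ Y⁻¹) (lt_min hδ (by positivity))
  have hLY : 0 < L Y := hLpos Y hY0
  refine ⟨2 * K * 2 ^ η, max M 0 * 2 ^ η / L Y ^ ρ, ?_⟩
  filter_upwards [Ioc_mem_nhdsGT (inv_pos.2 hY0)] with s ⟨hs, hsY⟩ τ hτ
  have hτ' : 0 < ‖τ‖ := norm_pos_iff.2 hτ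
  have hsY' : Y ≤ s⁻¹ := (le_inv_comm₀ hs hY0).1 hsY
  have hL₁ : 0 < L s⁻¹ := hLpos _ (by positivity)
  have hnorm : ‖s • τ‖ = s * ‖τ‖ := by rw [norm_smul, Real.norm_eq_abs, abs_of_pos hs]
  have hsplit : s ^ d * (s ^ b * L s⁻¹ ^ ρ)⁻¹ * g (s • τ) =
      s ^ (d - b) * g (s • τ) / L s⁻¹ ^ ρ := by
    rw [Real.rpow_sub hs]
    have := Real.rpow_pos_of_pos hs b
    field_simp
  rw [hsplit]
  rcases lt_or_ge (s * ‖τ‖) (min δ Y⁻¹) with h | h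
  · have h₁ := hgδ (s • τ) (smul_ne_zero hs.ne' hτ) (hnorm ▸ h.trans_le (min_le_left _ _))
    rw [hnorm, one_div, Real.mul_rpow hs.le hτ'.le] at h₁
    have hu : Y ≤ (s * ‖τ‖)⁻¹ :=
      (le_inv_comm₀ (by positivity) hY0).1 (h.le.trans (min_le_right _ _))
    have h₂ := hY (s * ‖τ‖)⁻¹ s⁻¹ (max ‖τ‖ ‖τ‖⁻¹) hu hsY'
      (by rw [mul_inv, mul_comm]; gcongr; exact le_max_right _ _)
      (calc s⁻¹ = ‖τ‖ * (s * ‖τ‖)⁻¹ := by field_simp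
        _ ≤ _ := by gcongr; exact le_max_left _ _)
    have h₃ : (2 * max ‖τ‖ ‖τ‖⁻¹) ^ η ≤ 2 ^ η * (‖τ‖ ^ η + ‖τ‖ ^ (-η)) := by
      have := Real.rpow_pos_of_pos hτ' η
      have := Real.rpow_pos_of_pos hτ' (-η)
      rw [Real.mul_rpow (by norm_num) (by positivity)]
      gcongr
      rcases max_choice ‖τ‖ ‖τ‖⁻¹ with h | h <;> rw [h]
      · linarith
      · rw [Real.inv_rpow hτ'.le, ← Real.rpow_neg hτ'.le]
        linarith
    have hC₂ : 0 ≤ max M 0 * 2 ^ η / L Y ^ ρ := by positivity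
    refine le_add_of_le_of_nonneg ?_ hC₂
    rw [div_le_iff₀ (by positivity), Real.rpow_add hτ', sub_eq_add_neg _ η, Real.rpow_add hτ',
      ← mul_add]
    have hinv : ‖τ‖ ^ (b - d) * ‖τ‖ ^ (d - b) = 1 := by
      rw [← Real.rpow_add hτ']
      simp
    calc s ^ (d - b) * g (s • τ)
        = ‖τ‖ ^ (b - d) * (g (s • τ) * (s ^ (d - b) * ‖τ‖ ^ (d - b))) := by
          linear_combination -(s ^ (d - b) * g (s • τ)) * hinv
      _ ≤ ‖τ‖ ^ (b - d) * (2 * K * ((2 ^ η * (‖τ‖ ^ η + ‖τ‖ ^ (-η))) * L s⁻¹ ^ ρ)) := by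
          refine mul_le_mul_of_nonneg_left (h₁.trans ?_) (by positivity)
          gcongr
          refine h₂.trans ?_
          gcongr
      _ = _ := by ring
  · have h₁ : g (s • τ) ≤ max M 0 := (hM _ (hnorm ▸ h)).trans (le_max_left _ _)
    have hs1 : 1 ≤ s⁻¹ := hY1.trans hsY'
    have h₂ := hY Y s⁻¹ s⁻¹ le_rfl hsY' (hsY'.trans (le_mul_of_one_le_left (by linarith) hs1))
      (le_mul_of_one_le_right (by linarith) hY1)
    refine le_add_of_nonneg_of_le (by positivity) ?_
    rw [div_le_div_iff₀ (by positivity) (by positivity)]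
    calc s ^ (d - b) * g (s • τ) * L Y ^ ρ
        ≤ s ^ (d - b) * max M 0 * ((2 * s⁻¹) ^ η * L s⁻¹ ^ ρ) := by
          gcongr
      _ = s ^ (d - b - η) * (max M 0 * 2 ^ η * L s⁻¹ ^ ρ) := by
          rw [Real.mul_rpow (by norm_num) (by positivity), Real.inv_rpow hs.le,
            Real.rpow_sub hs _ η]
          ring
      _ ≤ 1 * (max M 0 * 2 ^ η * L s⁻¹ ^ ρ) := by
          gcongr
          exact Real.rpow_le_one hs.le ((one_le_inv₀ hs).1 hs1) (by linarith)
      _ = _ := one_mul _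

end RescaledDensity

theorem rpow_eq_sq_rpow_half {a : ℝ} (ha : 0 ≤ a) (γ : ℝ) : a ^ γ = (a ^ 2) ^ (γ / 2) := by
  rw [← Real.rpow_natCast, ← Real.rpow_mul ha]
  congr 1
  push_cast
  ring

theorem mul_rpow_mul_add_sq_rpow_ge {c a e α γ : ℝ} (hc : 0 ≤ c) (ha : 0 < a) (he : 0 ≤ e)
    (hγ : 0 ≤ γ) : c * a ^ (α + γ) ≤ c * a ^ α * (e + a ^ 2) ^ (γ / 2) := by
  rw [Real.rpow_add ha, rpow_eq_sq_rpow_half ha.le γ, mul_assoc]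
  gcongr
  linarith

theorem tendsto_mul_rpow_mul_add_sq_rpow {c a α γ : ℝ} (ha : 0 < a) (hαγ : 0 < α + γ) :
    Tendsto (fun ε : ℝ => c * a ^ α * (ε ^ (2 / (α + γ)) + a ^ 2) ^ (γ / 2)) (𝓝[>] 0)
      (𝓝 (c * a ^ (α + γ))) := by
  have h₁ : Tendsto (fun ε : ℝ => ε ^ (2 / (α + γ))) (𝓝[>] 0) (𝓝 0) :=
    (tendsto_rpow_nhdsGT_zero (by positivity)).mono_right nhdsWithin_le_nhds
  have h₂ := (h₁.add_const (a ^ 2)).rpow_const (p := γ / 2) (Or.inl (by positivity))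
  rw [zero_add, ← rpow_eq_sq_rpow_half ha.le] at h₂
  rw [Real.rpow_add ha, ← mul_assoc]
  exact h₂.const_mul _

/-- The deterministic main-term computation (7.7) in the proof of Theorem 1: the
micro-rescaled spectral integral of a density `g` with Tauberian-type behaviour
`g(λ) ∼ K(n,b)·L^ρ(1/|λ|)·|λ|^{b−n}` at the origin converges to a Riesz-type
Fourier integral with combined exponent `α+γ`. -/
theorem micro_scaling_main_term
    (n : ℕ) (hn : 1 ≤ n) (μ α γ χ t t' : ℝ)
    (hμ : 0 < μ) (hα : 0 < α) (hγ : 0 ≤ γ) (hχ : 0 < χ) (ht : 0 < t) (ht' : 0 < t')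
    (x x' : EuclideanSpace ℝ (Fin n)) (b : ℝ) (hb0 : 0 < b) (hbn : b < n)
    (L : ℝ → ℝ) (hLpos : ∀ y > 0, 0 < L y) (hL : SlowlyVaryingAtTop L)
    (hLbdd : ∀ M > 0, ∃ C, ∀ y ∈ Set.Ioc (0:ℝ) M, L y ≤ C)
    (ρ : ℕ) (hρ : 1 ≤ ρ)
    (g : EuclideanSpace ℝ (Fin n) → ℝ) (hgmeas : Measurable g)
    (hgnonneg : ∀ l, 0 ≤ g l)
    (hgbdd : ∀ δ₀ > 0, ∃ C, ∀ l : EuclideanSpace ℝ (Fin n), δ₀ ≤ ‖l‖ → g l ≤ C)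
    (hgasymp : Tendsto
      (fun l : EuclideanSpace ℝ (Fin n) =>
        g l * ‖l‖ ^ ((n : ℝ) - b) / (tauberK n b * L (1 / ‖l‖) ^ ρ))
      (𝓝[≠] (0 : EuclideanSpace ℝ (Fin n))) (𝓝 1)) :
    Tendsto (fun ε : ℝ =>
        (↑(ε ^ ((n : ℝ) * χ) * (ε ^ (b * χ) * L (ε ^ (-χ)) ^ ρ)⁻¹) : ℂ) *
          ∫ τ : EuclideanSpace ℝ (Fin n),
            Complex.exp (Complex.I * ((⟪x - x', τ⟫ : ℝ) : ℂ)) *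
              ↑(Real.exp (-(μ * (t + t') * ‖τ‖ ^ α *
                  (ε ^ (2 / (α + γ)) + ‖τ‖ ^ 2) ^ (γ / 2))) * g ((ε ^ χ) • τ)))
      (𝓝[>] 0)
      (𝓝 ((tauberK n b : ℂ) *
        ∫ τ : EuclideanSpace ℝ (Fin n),
          Complex.exp (Complex.I * ((⟪x - x', τ⟫ : ℝ) : ℂ)) *
            ↑(Real.exp (-(μ * (t + t') * ‖τ‖ ^ (α + γ))) * ‖τ‖ ^ (b - (n : ℝ))))) := by
  have hK : 0 < tauberK n b := tauberK_pos hb0 hbn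
  have hρ0 : ρ ≠ 0 := by omega
  have hc : 0 < μ * (t + t') := by positivity
  have hp : 0 < α + γ := by positivity
  obtain ⟨η, hη, hηb, hηd⟩ : ∃ η > 0, η < b ∧ η ≤ n - b :=
    ⟨min (b / 2) (n - b), lt_min (by linarith) (by linarith),
      (min_le_left _ _).trans_lt (by linarith), min_le_right _ _⟩
  obtain ⟨C₁, C₂, hbound⟩ :=
    exists_rescaled_density_le hL hLpos hρ0 hK hgbdd hgasymp hη hηd
  have hscale : Tendsto (fun ε : ℝ => ε ^ χ) (𝓝[>] 0) (𝓝[>] 0) :=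
    tendsto_rpow_nhdsGT_zero hχ
  have hne : ∀ᵐ τ : EuclideanSpace ℝ (Fin n), τ ≠ 0 := by
    have : Nonempty (Fin n) := ⟨⟨0, hn⟩⟩
    exact Measure.ae_ne volume 0
  have hpre : ∀ ε : ℝ, 0 < ε → ε ^ ((n : ℝ) * χ) * (ε ^ (b * χ) * L (ε ^ (-χ)) ^ ρ)⁻¹ =
      (ε ^ χ) ^ (n : ℝ) * ((ε ^ χ) ^ b * L (ε ^ χ)⁻¹ ^ ρ)⁻¹ := by
    intro ε hε
    rw [mul_comm (n : ℝ), mul_comm b, Real.rpow_mul hε.le, Real.rpow_mul hε.le,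
      Real.rpow_neg hε.le]
  simp_rw [← integral_const_mul]
  refine tendsto_integral_filter_of_dominated_convergence
    (fun τ => Real.exp (-(μ * (t + t') * ‖τ‖ ^ (α + γ))) *
      (C₁ * (‖τ‖ ^ (b - n + η) + ‖τ‖ ^ (b - n - η)) + C₂)) ?_ ?_ ?_ ?_
  · refine Eventually.of_forall fun ε => Measurable.aestronglyMeasurable ?_
    fun_prop
  · filter_upwards [hscale.eventually hbound, self_mem_nhdsWithin] with ε hε hε0
    filter_upwards [hne] with τ hτ
    have hε0 : 0 < ε := hε0
    have hLε : 0 < L (ε ^ χ)⁻¹ := hLpos _ (by positivity)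
    have hexp := mul_rpow_mul_add_sq_rpow_ge (α := α) hc.le (norm_pos_iff.2 hτ)
      (Real.rpow_nonneg hε0.le (2 / (α + γ))) hγ
    rw [hpre ε hε0, norm_mul, norm_mul, Complex.norm_exp_I_mul_ofReal, one_mul,
      Complex.norm_real, Complex.norm_real, Real.norm_eq_abs, Real.norm_eq_abs,
      abs_of_nonneg (by positivity), abs_of_nonneg (mul_nonneg (Real.exp_nonneg _) (hgnonneg _)),
      mul_left_comm]
    have := hgnonneg ((ε ^ χ) • τ)
    gcongr
    exact hε τ hτ
  · have h := fun r hr => integrable_exp_neg_mul_norm_rpow_mul_norm_rpow (r := r) hn hc hp hr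
    have h₀ := h 0 (by rw [add_zero]; exact_mod_cast hn)
    simp only [Real.rpow_zero, mul_one] at h₀
    refine ((((h (b - n + η) (by linarith)).add (h (b - n - η) (by linarith))).const_mul C₁).add
      (h₀.const_mul C₂)).congr (Eventually.of_forall fun τ => ?_)
    simp only [Pi.add_apply]
    ring
  · filter_upwards [hne] with τ hτ
    have h₁ := (tendsto_rescaled_density hL hLpos hK hgasymp hτ).comp hscale
    have h₂ := (Real.continuous_exp.tendsto _).comp
      (tendsto_mul_rpow_mul_add_sq_rpow (c := μ * (t + t')) (norm_pos_iff.2 hτ) hp).neg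
    have h₃ := ((Complex.continuous_ofReal.tendsto _).comp (h₂.mul h₁)).const_mul
      (Complex.exp (Complex.I * ((⟪x - x', τ⟫ : ℝ) : ℂ)))
    have hlim : Complex.exp (Complex.I * ((⟪x - x', τ⟫ : ℝ) : ℂ)) *
        ((Real.exp (-(μ * (t + t') * ‖τ‖ ^ (α + γ))) *
          (tauberK n b * ‖τ‖ ^ (b - (n : ℝ))) : ℝ) : ℂ) =
        (tauberK n b : ℂ) * (Complex.exp (Complex.I * ((⟪x - x', τ⟫ : ℝ) : ℂ)) *
            ↑(Real.exp (-(μ * (t + t') * ‖τ‖ ^ (α + γ))) * ‖τ‖ ^ (b - (n : ℝ)))) := by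
      push_cast
      ring
    rw [hlim] at h₃
    refine h₃.congr' ?_
    filter_upwards [self_mem_nhdsWithin] with ε hε0
    rw [hpre ε hε0]
    simp only [Function.comp_apply]
    push_cast
    ring
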